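/- Let m ≥ 2, let F_m be the free group on m generators with free generating set S, let l denote the word length (reduced word length) on F_m with respect to S, and let μ be the uniform probability measure on the 2m-element set S ∪ S⁻¹. Then for every h ∈ F_m with h ≠ e and every integer k with 1 ≤ k ≤ l(h), μ^{*n}({g ∈ F_m : l(g·h) ≤ l(g) + l(h) − 2k}) → 1/(2m·(2m−1)^{k−1}) as n → ∞. -/

import Mathlib

noncomputable section
open Filter
open scoped Classical

/-- Convolution of two measures (as real-valued functions) on a group:
`(μ * ν)(g) = Σ_h μ(h) ν(h⁻¹ g)`. -/
def conv {G : Type*} [Group G] (μ ν : G → ℝ) : G → ℝ :=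
  fun g => ∑' h : G, μ h * ν (h⁻¹ * g)

/-- `n`-fold convolution power; `convPow μ 0` is the point mass at the identity. -/
def convPow {G : Type*} [Group G] (μ : G → ℝ) : ℕ → G → ℝ
  | 0 => fun g => if g = 1 then 1 else 0
  | n + 1 => conv μ (convPow μ n)

/-- Measure of a subset: `μ(A) = Σ_{x ∈ A} μ(x)`. -/
def measOf {G : Type*} (μ : G → ℝ) (A : Set G) : ℝ := ∑' x : A, μ x

/-- Word length of `g` with respect to `S ∪ S⁻¹`: the least `k` such that `g` is a
product of `k` elements of `S ∪ S⁻¹`. -/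
def wordLength {G : Type*} [Group G] (S : Set G) (g : G) : ℕ :=
  sInf {k | ∃ l : List G, l.length = k ∧ (∀ x ∈ l, x ∈ S ∨ x⁻¹ ∈ S) ∧ l.prod = g}

/-- The uniform probability measure on `S ∪ S⁻¹` in the free group `F_m`, where `S` is the
free generating set: each of the `2m` elements has weight `1/(2m)`. -/
def freeUnif (m : ℕ) : FreeGroup (Fin m) → ℝ :=
  Set.indicator {g : FreeGroup (Fin m) | ∃ i : Fin m, g = FreeGroup.of i ∨ g = (FreeGroup.of i)⁻¹}
    (fun _ => 1 / (2 * m))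

open FreeGroup in
lemma ev_aux {m : ℕ} : ∀ (k : ℕ) (X H : List (Fin m × Bool)), IsReduced X → IsReduced H →
    k ≤ H.length →
    ((reduce (invRev X ++ H)).length + 2 * k ≤ X.length + H.length ↔ H.take k <+: X) := by
  intro k
  induction k with
  | zero =>
    intro X H hX hH _
    have : (mk (invRev X ++ H)).norm ≤ (invRev X ++ H).length := norm_mk_le
    simp [FreeGroup.norm, toWord_mk] at this
    simpa using this
  | succ k ih =>
    intro X H hX hH hk
    cases H with
    | nil => simp at hk
    | cons b H =>
      cases X with
      | nil =>
        simp [hH.reduce_eq]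
      | cons a X =>
        by_cases hab : a = b
        · subst hab
          have e : reduce (invRev (a :: X) ++ a :: H) = reduce (invRev X ++ H) := by
            apply reduce.sound
            rw [← mul_mk, ← mul_mk, ← inv_mk, ← inv_mk,
              show a :: X = [a] ++ X from rfl, show a :: H = [a] ++ H from rfl, ← mul_mk, ← mul_mk]
            group
          have := ih X H (List.IsChain.tail hX) (List.IsChain.tail hH) (by simpa using hk)
          rw [e]
          simp only [List.length_cons, List.take_succ_cons, List.cons_prefix_cons, true_and]
          rw [← this]
          omega
        · have hr : IsReduced (invRev (a :: X) ++ b :: H) := by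
            have h1 : IsReduced (invRev (a :: X)) := by
              rw [isReduced_iff_reduce_eq, reduce_invRev, hX.reduce_eq]
            unfold FreeGroup.IsReduced at *
            rw [List.isChain_append]
            refine ⟨h1, hH, ?_⟩
            intro x hx y hy
            simp [invRev] at hx hy
            subst hx; subst hy
            intro h2
            simp only at h2 ⊢
            by_contra h3
            apply hab
            ext1
            · exact h2
            · revert h3; cases a.2 <;> cases b.2 <;> simp
          rw [hr.reduce_eq]
          simp [Ne.symm hab]

open FreeGroup in
lemma ev_iff {m : ℕ} (g h : FreeGroup (Fin m)) (k : ℕ) (hk : k ≤ h.norm) :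
    ((FreeGroup.norm (g * h) : ℤ) ≤ (FreeGroup.norm g : ℤ) + (FreeGroup.norm h : ℤ) - 2 * k) ↔
      h.toWord.take k <+: (g⁻¹).toWord := by
  rw [← ev_aux k (g⁻¹).toWord h.toWord isReduced_toWord isReduced_toWord hk, toWord_inv,
    invRev_invRev, ← toWord_mul, invRev_length]
  unfold FreeGroup.norm
  omega

def flipL {m : ℕ} (s : Fin m × Bool) : Fin m × Bool := (s.1, !s.2)

lemma flipL_flipL {m : ℕ} (s : Fin m × Bool) : flipL (flipL s) = s := by simp [flipL]

lemma flipL_ne {m : ℕ} (s : Fin m × Bool) : flipL s ≠ s := by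
  intro h; have := congrArg Prod.snd h; simp [flipL] at this

def gen {m : ℕ} (s : Fin m × Bool) : FreeGroup (Fin m) := FreeGroup.mk [s]

lemma gen_inj {m : ℕ} : Function.Injective (gen (m := m)) := by
  intro a b h
  have := congrArg FreeGroup.toWord h
  simpa [gen, FreeGroup.toWord_mk, FreeGroup.reduce_singleton] using this

lemma gen_flip {m : ℕ} (s : Fin m × Bool) : gen (flipL s) = (gen s)⁻¹ := by
  simp [gen, flipL, FreeGroup.inv_mk, FreeGroup.invRev]

open FreeGroup in
lemma toWord_gen_mul {m : ℕ} (s : Fin m × Bool) (x : FreeGroup (Fin m)) :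
    (gen s * x).toWord = if [flipL s] <+: x.toWord then x.toWord.tail else s :: x.toWord := by
  rw [toWord_mul, gen, toWord_mk, reduce_singleton, List.singleton_append, reduce.cons,
    reduce_toWord]
  cases h : x.toWord with
  | nil => simp
  | cons c t =>
    have : (s.1 = c.1 ∧ s.2 = !c.2) ↔ flipL s = c := by
      obtain ⟨s1, s2⟩ := s
      obtain ⟨c1, c2⟩ := c
      cases s2 <;> cases c2 <;> simp [flipL]
    simp [this]

open FreeGroup in
lemma pre_ne {m : ℕ} {a s : Fin m × Bool} (w : List (Fin m × Bool)) (x : FreeGroup (Fin m))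
    (hs : s ≠ a) : (a :: w) <+: (gen s * x).toWord ↔ (flipL s :: a :: w) <+: x.toWord := by
  rw [toWord_gen_mul]
  cases h : x.toWord with
  | nil => simp [Ne.symm hs]
  | cons c t =>
    by_cases hc : flipL s = c <;> simp [hc, List.cons_prefix_cons, Ne.symm hs]

open FreeGroup in
lemma pre_eq {m : ℕ} {a b : Fin m × Bool} (w : List (Fin m × Bool)) (x : FreeGroup (Fin m))
    (hw : IsReduced (a :: b :: w)) :
    (a :: b :: w) <+: (gen a * x).toWord ↔ (b :: w) <+: x.toWord := by
  rw [toWord_gen_mul]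
  have hab : b ≠ flipL a := by
    intro h
    have := (List.isChain_cons_cons.1 hw).1
    subst h
    simp [flipL] at this
  have hx : IsReduced x.toWord := isReduced_toWord
  cases h : x.toWord with
  | nil => simp
  | cons c t =>
    rw [h] at hx
    by_cases hc : flipL a = c
    · subst hc
      simp [List.cons_prefix_cons, hab]
      rintro ⟨t', ht⟩
      rw [← ht] at hx
      have := (List.isChain_cons_cons.1 hx).1
      simp [flipL] at this
    · simp [hc, List.cons_prefix_cons]

open FreeGroup in
lemma pre_one {m : ℕ} {a : Fin m × Bool} (x : FreeGroup (Fin m)) :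
    [a] <+: (gen a * x).toWord ↔ ¬ [flipL a] <+: x.toWord := by
  rw [toWord_gen_mul]
  have hx : IsReduced x.toWord := isReduced_toWord
  cases h : x.toWord with
  | nil => simp
  | cons c t =>
    rw [h] at hx
    by_cases hc : flipL a = c
    · subst hc
      simp [List.cons_prefix_cons]
      rintro ⟨t', ht⟩
      rw [← ht] at hx
      have := (List.isChain_cons_cons.1 hx).1
      simp [flipL] at this
    · simp [hc, List.cons_prefix_cons]

/-- expectation functional -/
def TT (m : ℕ) : ℕ → (FreeGroup (Fin m) → ℝ) → ℝ
  | 0, f => f 1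
  | n + 1, f => (1 / (2 * m)) * ∑ s : Fin m × Bool, TT m n (fun g => f (gen s * g))

lemma TT_succ (m n : ℕ) (f : FreeGroup (Fin m) → ℝ) : TT m (n + 1) f =
    (1 / (2 * m)) * ∑ s : Fin m × Bool, TT m n (fun g => f (gen s * g)) := rfl

lemma TT_right (m n : ℕ) : ∀ f : FreeGroup (Fin m) → ℝ,
    TT m (n + 1) f = (1 / (2 * m)) * ∑ s : Fin m × Bool, TT m n (fun g => f (g * gen s)) := by
  induction n with
  | zero => intro f; simp [TT]
  | succ n ih =>
    intro f
    rw [TT_succ]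
    simp only [ih]
    congr 1
    rw [← Finset.mul_sum, Finset.sum_comm, Finset.mul_sum]
    apply Finset.sum_congr rfl
    intro s _
    rw [← ih (fun g => f (g * gen s)), TT_succ]
    simp only [mul_assoc]

lemma TT_right_inv (m n : ℕ) (f : FreeGroup (Fin m) → ℝ) :
    TT m (n + 1) f =
      (1 / (2 * m)) * ∑ s : Fin m × Bool, TT m n (fun g => f (g * (gen s)⁻¹)) := by
  rw [TT_right]
  congr 1
  exact (Equiv.sum_comp (Function.Involutive.toPerm flipL flipL_flipL)
    (fun s => TT m n (fun g => f (g * gen s)))).symm.trans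
    (Finset.sum_congr rfl fun s _ => by
      change TT m n (fun g => f (g * gen (flipL s))) = _
      rw [gen_flip])

lemma TT_one_sub (m n : ℕ) (hm : 2 ≤ m) : ∀ f : FreeGroup (Fin m) → ℝ,
    TT m n (fun g => 1 - f g) = 1 - TT m n f := by
  have : (m : ℝ) ≠ 0 := by positivity
  induction n with
  | zero => intro f; simp [TT]
  | succ n ih =>
    intro f
    rw [TT, TT]
    simp_rw [ih]
    simp
    field_simp

lemma unif_conv (m : ℕ) (ν : FreeGroup (Fin m) → ℝ) (g : FreeGroup (Fin m)) :
    conv (freeUnif m) ν g = (1 / (2 * m)) * ∑ s : Fin m × Bool, ν ((gen s)⁻¹ * g) := by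
  have hset : {g : FreeGroup (Fin m) | ∃ i : Fin m, g = FreeGroup.of i ∨ g = (FreeGroup.of i)⁻¹}
      = Set.range gen := by
    ext x
    simp only [Set.mem_ofPred_eq, Set.mem_range, Prod.exists, Bool.exists_bool]
    refine exists_congr fun i => ?_
    rw [or_comm, ← eq_comm, @eq_comm _ x]
    simp [gen, FreeGroup.of, FreeGroup.inv_mk, FreeGroup.invRev]
  unfold conv freeUnif
  rw [hset, ← gen_inj.tsum_eq, tsum_fintype, Finset.mul_sum]
  · simp
  · intro x hx
    by_contra h
    exact hx (by beta_reduce; rw [Set.indicator_of_notMem h, zero_mul])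

lemma hasSum_TT (m n : ℕ) : ∀ f : FreeGroup (Fin m) → ℝ,
    HasSum (fun g => convPow (freeUnif m) n g * f g) (TT m n f) := by
  induction n with
  | zero =>
    intro f
    have := hasSum_single (f := fun g => convPow (freeUnif m) 0 g * f g) 1
      (by intro b hb; simp [convPow, hb])
    simpa [convPow, TT] using this
  | succ n ih =>
    intro f
    have h1 : ∀ s : Fin m × Bool, HasSum
        (fun g => convPow (freeUnif m) n ((gen s)⁻¹ * g) * f g)
        (TT m n (fun g => f (gen s * g))) := by
      intro s
      rw [← (Equiv.mulLeft (gen s)).hasSum_iff]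
      simpa [Function.comp_def] using ih (fun g => f (gen s * g))
    have h2 := (hasSum_sum (s := Finset.univ) (fun s _ => h1 s)).mul_left (1 / (2 * m : ℝ))
    rw [TT]
    have h3 : (fun g => convPow (freeUnif m) (n + 1) g * f g) = fun g => (1 / (2 * m : ℝ)) *
        ∑ s : Fin m × Bool, convPow (freeUnif m) n ((gen s)⁻¹ * g) * f g := by
      funext g
      change conv (freeUnif m) (convPow (freeUnif m) n) g * f g = _
      rw [unif_conv, mul_assoc, Finset.sum_mul]
    rw [h3]
    exact h2

lemma measOf_eq (m n : ℕ) (A : Set (FreeGroup (Fin m))) :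
    measOf (convPow (freeUnif m) n) A = TT m n (fun g => if g ∈ A then 1 else 0) := by
  rw [← (hasSum_TT m n _).tsum_eq, measOf, tsum_subtype A (convPow (freeUnif m) n)]
  congr 1
  ext g
  simp [Set.indicator]

def bet (q : ℝ) : ℕ → ℕ → ℝ
  | 0, _ => 0
  | n + 1, 0 => (q * bet q n 1 + (1 - bet q n 0)) / (q + 1)
  | n + 1, j + 1 => (q * bet q n (j + 2) + bet q n j) / (q + 1)

lemma TT_bet (m : ℕ) (hm : 2 ≤ m) (n : ℕ) : ∀ (a : Fin m × Bool) (w : List (Fin m × Bool)),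
    FreeGroup.IsReduced (a :: w) →
    TT m n (fun g => if (a :: w) <+: (g⁻¹).toWord then 1 else 0) = bet (2 * m - 1) n w.length := by
  induction n with
  | zero => intro a w _; simp [TT, bet]
  | succ n ih =>
    intro a w hw
    have hm0 : (m : ℝ) ≠ 0 := by positivity
    rw [TT_right_inv, ← Finset.add_sum_erase _ _ (Finset.mem_univ a)]
    have h1 : ∀ s ∈ Finset.univ.erase a, TT m n (fun g => if (a :: w) <+:
        ((g * (gen s)⁻¹)⁻¹).toWord then 1 else 0) = bet (2 * m - 1) n (w.length + 1) := by
      intro s hs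
      have hs' := Finset.ne_of_mem_erase hs
      rw [← List.length_cons (a := a), ← ih (flipL s) (a :: w)]
      · congr 1
        ext g
        rw [mul_inv_rev, inv_inv]
        simp only [pre_ne w _ hs']
      · refine List.isChain_cons_cons.2 ⟨?_, hw⟩
        intro h
        by_contra h3
        apply hs'
        ext1
        · exact h
        · revert h3; simp only [flipL]; cases a.2 <;> cases s.2 <;> simp
    rw [Finset.sum_congr rfl h1, Finset.sum_const, Finset.card_erase_of_mem (Finset.mem_univ a)]
    have hc : ((Finset.univ : Finset (Fin m × Bool)).card - 1 : ℕ) = (2 * m - 1 : ℝ) := by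
      rw [Finset.card_univ, Fintype.card_prod, Fintype.card_fin, Fintype.card_bool,
        Nat.cast_sub (by omega)]
      push_cast; ring
    rw [nsmul_eq_mul, hc]
    cases w with
    | nil =>
      have : (fun g : FreeGroup (Fin m) => if [a] <+: ((g * (gen a)⁻¹)⁻¹).toWord then (1:ℝ) else 0)
        = fun g => 1 - (if [flipL a] <+: (g⁻¹).toWord then (1:ℝ) else 0) := by
        ext g
        rw [mul_inv_rev, inv_inv]
        simp only [pre_one]
        split_ifs <;> simp
      rw [this, TT_one_sub m n hm, ih _ _ FreeGroup.IsReduced.singleton]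
      simp [bet]
      field_simp
      ring
    | cons b w =>
      have : (fun g : FreeGroup (Fin m) => if (a :: b :: w) <+: ((g * (gen a)⁻¹)⁻¹).toWord
          then (1:ℝ) else 0) = fun g => (if (b :: w) <+: (g⁻¹).toWord then (1:ℝ) else 0) := by
        ext g
        rw [mul_inv_rev, inv_inv]
        simp only [pre_eq w _ hw]
      rw [this, ih _ _ (List.IsChain.tail hw)]
      simp [bet]
      field_simp
      ring

lemma bet_bound (q t : ℝ) (hq : 3 ≤ q) (ht : 0 < t) (htq : t * t * q = 1) (n : ℕ) : ∀ j : ℕ,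
    |1 / ((q + 1) * q ^ j) - bet q n j| ≤ (2 * q * t / (q + 1)) ^ n * t ^ j := by
  have hq0 : 0 < q := by linarith
  have ht1 : t ≤ 1 := by nlinarith
  induction n with
  | zero =>
    intro j
    have h1 : 1 / ((q + 1) * q ^ j) = 1 / (q + 1) * (t * t) ^ j := by
      have : t * t = q⁻¹ := eq_inv_of_mul_eq_one_left htq
      rw [this, inv_pow]; field_simp
    simp only [bet, sub_zero, pow_zero, one_mul]
    rw [abs_of_pos (by positivity), h1, mul_pow]
    have h2 : t ^ j ≤ 1 := pow_le_one₀ ht.le ht1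
    have h3 : 1 / (q + 1) ≤ 1 := by rw [div_le_one (by linarith)]; linarith
    have h4 : 0 < t ^ j := by positivity
    calc 1 / (q + 1) * (t ^ j * t ^ j) ≤ 1 * (t ^ j * 1) := by gcongr
      _ = t ^ j := by ring
  | succ n ih =>
    intro j
    set r := (2 * q * t / (q + 1)) ^ n with hr
    have hr0 : 0 ≤ r := by positivity
    cases j with
    | zero =>
      have e : 1 / ((q + 1) * q ^ 0) - bet q (n + 1) 0 =
        (q * (1 / ((q + 1) * q ^ 1) - bet q n 1) - (1 / ((q + 1) * q ^ 0) - bet q n 0)) / (q + 1) := by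
        simp only [bet]; field_simp; ring
      rw [e, abs_div, abs_of_pos (show 0 < q + 1 by linarith), pow_succ _ n, ← hr, div_le_iff₀ (by linarith)]
      have a1 := ih 1
      have a0 := ih 0
      calc _ ≤ |q * (1 / ((q + 1) * q ^ 1) - bet q n 1)| + |1 / ((q + 1) * q ^ 0) - bet q n 0| := abs_sub _ _
        _ ≤ q * (r * t ^ 1) + r * t ^ 0 := by rw [abs_mul, abs_of_pos hq0]; gcongr
        _ ≤ q * (r * t) + r * (q * t) := by
          have : 1 ≤ q * t := by nlinarith
          simp only [pow_one, pow_zero]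
          gcongr
        _ = _ := by field_simp; ring
    | succ j =>
      have e : 1 / ((q + 1) * q ^ (j + 1)) - bet q (n + 1) (j + 1) =
        (q * (1 / ((q + 1) * q ^ (j + 2)) - bet q n (j + 2)) + (1 / ((q + 1) * q ^ j) - bet q n j)) / (q + 1) := by
        simp only [bet]; field_simp; ring
      rw [e, abs_div, abs_of_pos (show 0 < q + 1 by linarith), pow_succ _ n, ← hr, div_le_iff₀ (by linarith)]
      have a1 := ih (j + 2)
      have a0 := ih j
      calc _ ≤ |q * (1 / ((q + 1) * q ^ (j + 2)) - bet q n (j + 2))| + |1 / ((q + 1) * q ^ j) - bet q n j| := abs_add_le _ _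
        _ ≤ q * (r * t ^ (j + 2)) + r * t ^ j := by rw [abs_mul, abs_of_pos hq0]; gcongr
        _ = q * (r * t ^ (j + 2)) + r * t ^ j * (t * t * q) := by rw [htq, mul_one]
        _ = _ := by field_simp; ring

lemma bet_tendsto (q : ℝ) (hq : 3 ≤ q) (j : ℕ) :
    Tendsto (fun n => bet q n j) atTop (nhds (1 / ((q + 1) * q ^ j))) := by
  have hq0 : 0 < q := by linarith
  have hs : 0 < Real.sqrt q := Real.sqrt_pos.2 hq0
  have hss : Real.sqrt q * Real.sqrt q = q := Real.mul_self_sqrt hq0.le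
  have hb := bet_bound q (Real.sqrt q)⁻¹ hq (by positivity)
    (by rw [← mul_inv, hss]; field_simp)
  have hlt : 2 * q * (Real.sqrt q)⁻¹ / (q + 1) < 1 := by
    rw [div_lt_one (by linarith), ← div_eq_mul_inv, div_lt_iff₀ hs]
    have : 1 < Real.sqrt q := by nlinarith
    nlinarith [mul_pos hs (mul_pos (sub_pos.2 this) (sub_pos.2 this))]
  have ht := (tendsto_pow_atTop_nhds_zero_of_lt_one (by positivity) hlt).mul_const
    ((Real.sqrt q)⁻¹ ^ j)
  rw [zero_mul] at ht
  rw [tendsto_iff_dist_tendsto_zero]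
  refine squeeze_zero (fun _ => dist_nonneg) (fun n => ?_) ht
  rw [dist_comm, Real.dist_eq]
  exact hb n j

/-- (Distribution of `l(g h) - l(g)` for simple random walks on free
groups.) For `m ≥ 2`, `h ≠ e` and `1 ≤ k ≤ l(h)`, the `μ^{*n}`-probability of
`{g : l(g h) ≤ l(g) + l(h) - 2k}` tends to `1/(2m (2m-1)^{k-1})` as `n → ∞`, where `l`
denotes the reduced word length and `μ` the uniform measure on `S ∪ S⁻¹`. -/
theorem stmt18 (m : ℕ) (hm : 2 ≤ m) (h : FreeGroup (Fin m)) (hh : h ≠ 1)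
    (k : ℕ) (hk1 : 1 ≤ k) (hk2 : k ≤ FreeGroup.norm h) :
    Tendsto (fun n => measOf (convPow (freeUnif m) n)
        {g : FreeGroup (Fin m) |
          (FreeGroup.norm (g * h) : ℤ) ≤
            (FreeGroup.norm g : ℤ) + (FreeGroup.norm h : ℤ) - 2 * k})
      atTop (nhds (1 / (2 * m * (2 * m - 1) ^ (k - 1) : ℝ))) := by
  obtain ⟨j, rfl⟩ : ∃ j, k = j + 1 := ⟨k - 1, by omega⟩
  have hm' : (2 : ℝ) ≤ m := by exact_mod_cast hm
  have key := bet_tendsto (2 * m - 1) (by linarith) j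
  have e : (1 / (2 * m * (2 * m - 1) ^ (j + 1 - 1) : ℝ)) =
      1 / ((2 * m - 1 + 1) * (2 * m - 1) ^ j) := by simp
  rw [e]
  refine key.congr fun n => ?_
  rw [measOf_eq]
  simp only [Set.mem_ofPred_eq, ev_iff _ h (j + 1) hk2]
  have hr : FreeGroup.IsReduced h.toWord := FreeGroup.isReduced_toWord
  unfold FreeGroup.norm at hk2
  cases hw : h.toWord with
  | nil => simp [hw] at hk2
  | cons a w =>
    rw [hw] at hk2 hr
    simp only [List.take_succ_cons]
    have hl : (List.take j w).length = j := by simpa using hk2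
    rw [← hl]
    refine Eq.trans ?_ ((TT_bet m hm n a (List.take j w) ?_).symm.trans ?_)
    · rw [hl]
    rotate_left
    · congr 1
      ext g
      simp only [hl]
    · have := hr.infix (List.take_prefix (j + 1) (a :: w)).isInfix
      simpa using this
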